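/- Let n be an even positive integer and k ≥ 2, and let G be a k-partite graph on n vertices with vertex set partitioned as {X₁, X₂, …, X_k}. Suppose |X_i| ≤ n/2 for all i ∈ {1, …, k}, and suppose that for every i and every vertex x ∈ X_i, the degree satisfies d(x) > (3/4)n − |X_i|. Then G is connected and contains a perfect matching. -/

import Mathlib

open Classical in
lemma kp_core {V K ι : Type*} [Fintype V] (G : SimpleGraph V) (f : V → ι) (n : ℝ)
    (hcard : (Fintype.card V : ℝ) = n)
    (hsize : ∀ i, ((Finset.univ.filter fun v => f v = i).card : ℝ) ≤ n / 2)
    (hdeg : ∀ x, ((Finset.univ.filter fun y => f y ≠ f x ∧ ¬ G.Adj x y).card : ℝ) < n / 4)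
    (W : Finset V) (c : V → K) (hc : ∀ x ∈ W, ∀ y ∈ W, G.Adj x y → c x = c y)
    (T : Finset K) (hT : ∀ t ∈ T, ∃ x ∈ W, c x = t)
    (s : ℝ) (hs0 : 0 ≤ s) (hs : (W.card : ℝ) + s = n) (hq : s + 2 ≤ T.card) : False := by
  -- basic bound
  have key : ∀ x ∈ W, ∀ A ⊆ W, (∀ y ∈ A, f y ≠ f x ∧ c y ≠ c x) → (A.card : ℝ) < n / 4 := by
    intro x hx A hA h
    refine lt_of_le_of_lt ?_ (hdeg x)
    norm_cast
    apply Finset.card_le_card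
    intro y hy
    simp only [Finset.mem_filter, Finset.mem_univ, true_and]
    exact ⟨(h y hy).1, fun hadj => (h y hy).2 (hc x hx y (hA hy) hadj).symm⟩
  have hTW : (T.card : ℝ) ≤ W.card := by
    norm_cast
    have : T ⊆ W.image c := by
      intro t ht
      obtain ⟨x, hx, rfl⟩ := hT t ht
      exact Finset.mem_image_of_mem _ hx
    exact (Finset.card_le_card this).trans Finset.card_image_le
  have hsn : s + 1 ≤ n / 2 := by linarith
  have hTpos : (0 : ℝ) < T.card := by linarith
  have hTne : T.Nonempty := by
    rw [← Finset.card_pos]; exact_mod_cast hTpos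
  have fiber : ∀ A : Finset V, ∃ t ∈ T,
      ((A.filter fun x => c x = t).card : ℝ) * (s + 2) ≤ A.card := by
    intro A
    obtain ⟨t, ht, h⟩ := Finset.exists_card_fiber_le_of_card_le_nsmul (s := A) (t := T) (f := c)
      (b := (A.card : ℝ) / T.card) hTne (by rw [nsmul_eq_mul]; field_simp; exact le_refl _)
    refine ⟨t, ht, ?_⟩
    rw [le_div_iff₀ hTpos] at h
    refine le_trans ?_ h
    gcongr
  obtain ⟨C, hC, hCs⟩ := fiber W
  obtain ⟨x, hx, rfl⟩ := hT C hC
  have split : ∀ (A : Finset V) (p : V → Prop),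
      ((A.filter p).card : ℝ) + (A.filter fun v => ¬ p v).card = A.card := by
    intro A p
    exact_mod_cast Finset.card_filter_add_card_filter_not p
  -- every component meets the part of x
  have meets : ∀ t ∈ T, ∃ y ∈ W, c y = t ∧ f y = f x := by
    intro t ht
    by_contra! hno
    obtain ⟨z, hz, rfl⟩ := hT t ht
    have h1 := key z hz (W.filter fun v => f v = f x) (Finset.filter_subset _ _) (by
      intro y hy
      rw [Finset.mem_filter] at hy
      exact ⟨fun h => hno z hz rfl (h.symm.trans hy.2), fun h => hno y hy.1 h hy.2⟩)
    have h2 := key x hx ((W.filter fun v => ¬ c v = c x).filter fun v => ¬ f v = f x)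
      (fun y hy => by simp only [Finset.mem_filter] at hy; exact hy.1.1) (by
      intro y hy
      simp only [Finset.mem_filter] at hy
      exact ⟨hy.2, hy.1.2⟩)
    have h3 := split W (fun v => c v = c x)
    have h4 := split (W.filter fun v => ¬ c v = c x) (fun v => f v = f x)
    have h5 : ((((W.filter fun v => ¬ c v = c x).filter fun v => f v = f x)).card : ℝ)
        ≤ (W.filter fun v => f v = f x).card := by
      norm_cast
      apply Finset.card_le_card
      intro y hy
      simp only [Finset.mem_filter] at hy ⊢
      exact ⟨hy.1.1, hy.2⟩
    set a := ((W.filter fun v => c v = c x).card : ℝ)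
    have h6 : (W.card : ℝ) - a < n / 2 := by linarith
    nlinarith [mul_nonneg hs0 (sub_nonneg.2 hsn),
      mul_pos (sub_pos.2 h6) (by linarith : (0 : ℝ) < s + 2)]
  have hXi : ((W.filter fun v => f v = f x).card : ℝ) ≤ n / 2 := by
    refine le_trans ?_ (hsize (f x))
    norm_cast
    exact Finset.card_le_card (Finset.filter_subset_filter _ (Finset.subset_univ _))
  have hsp := split W (fun v => f v = f x)
  have hpos : (0 : ℝ) < (W.filter fun v => ¬ f v = f x).card := by linarith
  obtain ⟨y, hy⟩ := Finset.card_pos.1 (by exact_mod_cast hpos)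
  rw [Finset.mem_filter] at hy
  have hsm : s + 1 < n / 4 := by
    have : Nonempty V := ⟨x⟩
    choose! g hgW hgc hgf using meets
    have h1 := key y hy.1 ((T.erase (c y)).image g)
      (fun z hz => by
        obtain ⟨t, ht, rfl⟩ := Finset.mem_image.1 hz
        exact hgW t (Finset.mem_of_mem_erase ht))
      (by
        intro z hz
        obtain ⟨t, ht, rfl⟩ := Finset.mem_image.1 hz
        have htT := Finset.mem_of_mem_erase ht
        rw [hgf t htT, hgc t htT]
        exact ⟨fun h => hy.2 h.symm, Finset.ne_of_mem_erase ht⟩)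
    rw [Finset.card_image_of_injOn (by
      intro a ha b hb hab
      rw [← hgc a (Finset.mem_of_mem_erase ha), ← hgc b (Finset.mem_of_mem_erase hb)]
      exact congrArg c hab)] at h1
    have h2 : T.card ≤ (T.erase (c y)).card + 1 := by
      have := Finset.pred_card_le_card_erase (s := T) (a := c y)
      omega
    have h3 : (T.card : ℝ) ≤ (T.erase (c y)).card + 1 := by exact_mod_cast h2
    linarith
  obtain ⟨D, hD, hDs⟩ := fiber (W.filter fun v => ¬ f v = f x)
  obtain ⟨z, hz, rfl, hzf⟩ := meets D hD
  have h1 := key z hz ((W.filter fun v => ¬ f v = f x).filter fun v => ¬ c v = c z)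
    (fun y hy => by simp only [Finset.mem_filter] at hy; exact hy.1.1) (by
    intro y hy
    simp only [Finset.mem_filter] at hy
    rw [hzf]
    exact ⟨hy.1.2, hy.2⟩)
  have h2 := split (W.filter fun v => ¬ f v = f x) (fun v => c v = c z)
  set b := ((W.filter fun v => ¬ f v = f x).card : ℝ)
  set d := (((W.filter fun v => ¬ f v = f x).filter fun v => c v = c z).card : ℝ)
  have h3 : b - d < n / 4 := by linarith
  have h4 : n / 2 - s ≤ b := by linarith
  nlinarith [mul_nonneg hs0 (sub_nonneg.2 hsm.le),
      mul_pos (sub_pos.2 h3) (by linarith : (0 : ℝ) < s + 2),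
      mul_nonneg (sub_nonneg.2 h4) (by linarith : (0 : ℝ) ≤ s + 1)]


/-- Let `n` be even and positive, `k ≥ 2`, and let `G` be a `k`-partite graph on `n`
vertices with parts `X 0, …, X (k-1)`, each of size at most `n/2`.  If every vertex
`x ∈ X i` has degree greater than `(3/4)n − |X i|`, then `G` is connected and contains
a perfect matching. -/
theorem kpartite_min_degree_perfect_matching (n k : ℕ) (hn : 0 < n) (hne : Even n)
    (hk : 2 ≤ k) {V : Type*} [Fintype V] (hcard : Fintype.card V = n)
    (X : Fin k → Set V) (hpart : ∀ v : V, ∃! i : Fin k, v ∈ X i)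
    (G : SimpleGraph V)
    (hkpartite : ∀ i : Fin k, ∀ u ∈ X i, ∀ v ∈ X i, ¬ G.Adj u v)
    (hsize : ∀ i : Fin k, ((X i).ncard : ℝ) ≤ (n : ℝ) / 2)
    (hdeg : ∀ i : Fin k, ∀ x ∈ X i,
      (3 : ℝ) / 4 * (n : ℝ) - ((X i).ncard : ℝ) < ((G.neighborSet x).ncard : ℝ)) :
    G.Connected ∧ ∃ M : G.Subgraph, M.IsPerfectMatching := by

  classical
  choose f hf hfu using hpart
  have hX : ∀ i, X i = {v | f v = i} := by
    intro i; ext v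
    exact ⟨fun h => (hfu v i h).symm, fun h => by have := hf v; rwa [show f v = i from h] at this⟩
  have hXc : ∀ i, (X i).ncard = (Finset.univ.filter fun v => f v = i).card := by
    intro i
    rw [hX, ← Set.ncard_coe_finset]; simp
  have hcardR : (Fintype.card V : ℝ) = (n : ℝ) := by exact_mod_cast hcard
  have hsize' : ∀ i, ((Finset.univ.filter fun v => f v = i).card : ℝ) ≤ (n : ℝ) / 2 := by
    intro i; rw [← hXc]; exact hsize i
  have hdeg' : ∀ x, ((Finset.univ.filter fun y => f y ≠ f x ∧ ¬ G.Adj x y).card : ℝ)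
      < (n : ℝ) / 4 := by
    intro x
    have h := hdeg (f x) x (hf x)
    rw [hXc] at h
    have hN : (G.neighborSet x).ncard = (Finset.univ.filter fun y => G.Adj x y).card := by
      rw [← Set.ncard_coe_finset]; congr 1; ext; simp
    rw [hN] at h
    have h1 : (Finset.univ.filter fun y => f y ≠ f x ∧ ¬ G.Adj x y).card
        + (Finset.univ.filter fun v => f v = f x).card
        + (Finset.univ.filter fun y => G.Adj x y).card ≤ n := by
      rw [← hcard, ← Finset.card_univ, ← Finset.card_union_of_disjoint,
        ← Finset.card_union_of_disjoint]
      · exact Finset.card_le_card (Finset.subset_univ _)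
      · rw [Finset.disjoint_left]
        intro y hy hy'
        simp only [Finset.mem_union, Finset.mem_filter, Finset.mem_univ, true_and] at hy hy'
        rcases hy with hy | hy
        · exact hy.2 hy'
        · exact hkpartite (f x) x (hf x) y (hy ▸ hf y) hy'
      · rw [Finset.disjoint_left]
        intro y hy hy'
        simp only [Finset.mem_filter, Finset.mem_univ, true_and] at hy hy'
        exact hy.1 hy'
    have h2 : ((Finset.univ.filter fun y => f y ≠ f x ∧ ¬ G.Adj x y).card : ℝ)
        + (Finset.univ.filter fun v => f v = f x).card
        + (Finset.univ.filter fun y => G.Adj x y).card ≤ n := by exact_mod_cast h1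
    linarith
  constructor
  · have : Nonempty V := Fintype.card_pos_iff.1 (by omega)
    refine ⟨?_⟩
    intro u v
    by_contra huv
    refine kp_core G f n hcardR (fun i => by convert hsize' i) (fun x => by convert hdeg' x) Finset.univ G.connectedComponentMk
      (fun x _ y _ h => SimpleGraph.ConnectedComponent.sound h.reachable)
      {G.connectedComponentMk u, G.connectedComponentMk v} ?_ 0 le_rfl ?_ ?_
    · intro t _
      induction t using SimpleGraph.ConnectedComponent.ind with
      | _ w => exact ⟨w, Finset.mem_univ _, rfl⟩
    · rw [Finset.card_univ, hcardR, add_zero]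
    · rw [Finset.card_pair (fun h => huv (SimpleGraph.ConnectedComponent.exact h))]; norm_num
  · rw [SimpleGraph.tutte]
    intro u hu
    unfold SimpleGraph.IsTutteViolator at hu
    set H := ((⊤ : G.Subgraph).deleteVerts u) with hH
    have hmem : ∀ v, v ∈ H.verts ↔ v ∉ u := by intro v; simp [hH]
    have hVc : Nat.card H.verts + u.ncard = n := by
      have : H.verts = uᶜ := by ext v; simp [hmem]
      rw [this, Nat.card_coe_set_eq, ← hcard, ← Nat.card_eq_fintype_card, add_comm]
      exact Set.ncard_add_ncard_compl u
    have hpar := H.coe.odd_ncard_oddComponents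
    have hq : u.ncard + 2 ≤ H.coe.oddComponents.ncard := by
      rcases hne with ⟨m, hm⟩
      rw [Nat.odd_iff, Nat.odd_iff] at hpar
      omega
    let c : V → Option H.coe.ConnectedComponent := fun v =>
      if h : v ∈ H.verts then some (H.coe.connectedComponentMk ⟨v, h⟩) else none
    have hcv : ∀ v (h : v ∈ H.verts), c v = some (H.coe.connectedComponentMk ⟨v, h⟩) :=
      fun v h => dif_pos h
    have hfin : H.coe.oddComponents.Finite := Set.toFinite _
    refine kp_core G f n hcardR (fun i => by convert hsize' i) (fun x => by convert hdeg' x) (Finset.univ.filter fun v => v ∈ H.verts) c ?_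
      (hfin.toFinset.map Function.Embedding.some) ?_ u.ncard (Nat.cast_nonneg _) ?_ ?_
    · intro x hx y hy hxy
      have hx' := (Finset.mem_filter.1 hx).2
      have hy' := (Finset.mem_filter.1 hy).2
      rw [hcv x hx', hcv y hy']
      congr 1
      apply SimpleGraph.ConnectedComponent.sound
      apply SimpleGraph.Adj.reachable
      have hx2 := (hmem x).1 hx'
      have hy2 := (hmem y).1 hy'
      simp [hH, hx2, hy2, hxy]
    · intro t ht
      obtain ⟨d, _, rfl⟩ := Finset.mem_map.1 ht
      induction d using SimpleGraph.ConnectedComponent.ind with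
      | _ w => exact ⟨w.1, Finset.mem_filter.2 ⟨Finset.mem_univ _, w.2⟩, hcv w.1 w.2⟩
    · rw [← hVc, Nat.card_eq_fintype_card, Fintype.card_subtype]
      push_cast
      rfl
    · rw [Finset.card_map, ← Set.ncard_eq_toFinset_card _ hfin]
      exact_mod_cast hq
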